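/- Assume n = 2, M is irreducible, ρ(M) = 0 and every matrix in M is invertible, and let v be a Barabanov norm. Then the Barabanov unit ball {x : v(x) ≤ 1} is strictly convex: for all x ≠ y in ℝ² with v(x) = v(y) = 1 and every λ ∈ (0,1), one has v(λx + (1−λ)y) < 1. -/

import Mathlib

open MeasureTheory Filter Topology RealInnerProductSpace Matrix

noncomputable section

abbrev Vec (n : ℕ) := EuclideanSpace ℝ (Fin n)

def mulE {n : ℕ} (A : Matrix (Fin n) (Fin n) ℝ) (y : Vec n) : Vec n :=
  Matrix.toEuclideanLin A y

def IsSolutionWith {n : ℕ} (M : Set (Matrix (Fin n) (Fin n) ℝ))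
    (A : ℝ → Matrix (Fin n) (Fin n) ℝ) (x : ℝ → Vec n) : Prop :=
  (∀ i j, Measurable fun t => A t i j) ∧ (∀ t, A t ∈ M) ∧
    ContinuousOn x (Set.Ici 0) ∧
    ∀ t ≥ (0:ℝ), x t = x 0 + ∫ s in (0:ℝ)..t, mulE (A s) (x s)

def IsSolution {n : ℕ} (M : Set (Matrix (Fin n) (Fin n) ℝ)) (x : ℝ → Vec n) : Prop :=
  ∃ A, IsSolutionWith M A x

def IsAdjointWith {n : ℕ} (A : ℝ → Matrix (Fin n) (Fin n) ℝ) (l : ℝ → Vec n) : Prop :=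
  ContinuousOn l (Set.Ici 0) ∧
    ∀ t ≥ (0:ℝ), l t = l 0 - ∫ s in (0:ℝ)..t, mulE ((A s)ᵀ) (l s)

def IsNorm {n : ℕ} (v : Vec n → ℝ) : Prop :=
  (∀ x, v x = 0 ↔ x = 0) ∧ (∀ (a : ℝ) (x : Vec n), v (a • x) = |a| * v x) ∧
    ∀ x y, v (x + y) ≤ v x + v y

def IsBarabanov {n : ℕ} (M : Set (Matrix (Fin n) (Fin n) ℝ)) (v : Vec n → ℝ) : Prop :=
  IsNorm v ∧ (∀ x, IsSolution M x → ∀ t ≥ (0:ℝ), v (x t) ≤ v (x 0)) ∧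
    ∀ y : Vec n, ∃ x, IsSolution M x ∧ x 0 = y ∧ ∀ t ≥ (0:ℝ), v (x t) = v y

def IsExtremal {n : ℕ} (M : Set (Matrix (Fin n) (Fin n) ℝ)) (v : Vec n → ℝ)
    (x : ℝ → Vec n) : Prop :=
  IsSolution M x ∧ ∀ t ≥ (0:ℝ), v (x t) = v (x 0)

def subdiff {n : ℕ} (v : Vec n → ℝ) (x : Vec n) : Set (Vec n) :=
  {l | ⟪l, x⟫ = v x ∧ ∀ y, ⟪l, y⟫ ≤ v y}

def MIrreducible {n : ℕ} (M : Set (Matrix (Fin n) (Fin n) ℝ)) : Prop :=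
  ∀ W : Submodule ℝ (Vec n), (∀ A ∈ M, ∀ x ∈ W, mulE A x ∈ W) → W = ⊥ ∨ W = ⊤

def rhoZero {n : ℕ} (M : Set (Matrix (Fin n) (Fin n) ℝ)) : Prop :=
  sSup {r : EReal | ∃ x, IsSolution M x ∧ x 0 ≠ 0 ∧
      r = limsup (fun t => ((Real.log ‖x t‖ / t : ℝ) : EReal)) atTop} = 0

def MaxCondWith {n : ℕ} (M : Set (Matrix (Fin n) (Fin n) ℝ))
    (A : ℝ → Matrix (Fin n) (Fin n) ℝ) (x l : ℝ → Vec n) : Prop :=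
  ∀ᵐ t ∂(volume.restrict (Set.Ici (0:ℝ))),
    ∀ B ∈ M, ⟪l t, mulE B (x t)⟫ ≤ ⟪l t, mulE (A t) (x t)⟫

def ConditionG {n : ℕ} (M : Set (Matrix (Fin n) (Fin n) ℝ)) : Prop :=
  ∀ (x₀ l₀ : Vec n), x₀ ≠ 0 → l₀ ≠ 0 →
  ∀ A₁ A₂ (x₁ x₂ l₁ l₂ : ℝ → Vec n),
    IsSolutionWith M A₁ x₁ → IsSolutionWith M A₂ x₂ →
    IsAdjointWith A₁ l₁ → IsAdjointWith A₂ l₂ →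
    x₁ 0 = x₀ → x₂ 0 = x₀ → l₁ 0 = l₀ → l₂ 0 = l₀ →
    MaxCondWith M A₁ x₁ l₁ → MaxCondWith M A₂ x₂ l₂ →
    ∀ t ≥ (0:ℝ), x₁ t = x₂ t ∧ l₁ t = l₂ t

def omegaLimitSet {n : ℕ} (x : ℝ → Vec n) : Set (Vec n) :=
  {p | ∃ tk : ℕ → ℝ, Tendsto tk atTop atTop ∧ Tendsto (fun k => x (tk k)) atTop (𝓝 p)}

theorem mulE_eq_sum {n : ℕ} (A : Matrix (Fin n) (Fin n) ℝ) (y : Vec n) :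
    mulE A y = ∑ i, ∑ j, (A i j * y j) • EuclideanSpace.single i (1 : ℝ) := by
  ext k
  simp [mulE, Matrix.toEuclideanLin, Matrix.mulVec, dotProduct, Finset.sum_apply,
    Pi.single_apply]

/-- The velocity of a solution is integrable on every bounded interval. -/
theorem IsSolutionWith.intervalIntegrable {n : ℕ} {M : Set (Matrix (Fin n) (Fin n) ℝ)}
    (hM : IsCompact M) {A : ℝ → Matrix (Fin n) (Fin n) ℝ} {x : ℝ → Vec n}
    (h : IsSolutionWith M A x) {t : ℝ} (ht : 0 ≤ t) :
    IntervalIntegrable (fun s => mulE (A s) (x s)) volume 0 t := by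
  obtain ⟨hmeas, hmem, hcont, -⟩ := h
  simp only [mulE_eq_sum]
  rw [intervalIntegrable_iff_integrableOn_Icc_of_le ht]
  refine integrable_finsetSum _ fun i _ => integrable_finsetSum _ fun j _ =>
    Integrable.smul_const ?_ _
  obtain ⟨C, hC⟩ := hM.exists_bound_of_continuousOn (f := fun B => B i j) (by fun_prop)
  refine Integrable.bdd_mul (c := C) ?_ (hmeas i j).aestronglyMeasurable
    (Eventually.of_forall fun s => hC _ (hmem s))
  refine ContinuousOn.integrableOn_Icc ?_
  exact (EuclideanSpace.proj (𝕜 := ℝ) j).continuous.comp_continuousOn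
    (hcont.mono Set.Icc_subset_Ici_self)

/-- Constant switching signals have solutions that are differentiable at the initial time. -/
theorem exists_isSolution_hasDerivAt {n : ℕ} {M : Set (Matrix (Fin n) (Fin n) ℝ)}
    {A : Matrix (Fin n) (Fin n) ℝ} (hA : A ∈ M) (z : Vec n) :
    ∃ x, IsSolution M x ∧ x 0 = z ∧ HasDerivAt x (mulE A z) 0 := by
  set L : Vec n →L[ℝ] Vec n := (Matrix.toEuclideanLin A).toContinuousLinearMap
  have hd : ∀ t : ℝ, HasDerivAt (fun t : ℝ => NormedSpace.exp (t • L) z)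
      (mulE A (NormedSpace.exp (t • L) z)) t := fun t =>
    (hasDerivAt_exp_smul_const' L t).clm_apply (hasDerivAt_const t z) |>.congr_deriv (by
      simp [L, mulE])
  have h0 : NormedSpace.exp ((0 : ℝ) • L) z = z := by
    rw [show (0 : ℝ) • L = 0 from zero_smul ℝ L, NormedSpace.exp_zero,
      ContinuousLinearMap.one_apply]
  have hc : Continuous fun t : ℝ => NormedSpace.exp (t • L) z :=
    continuous_iff_continuousAt.2 fun t => (hd t).continuousAt
  refine ⟨_, ⟨fun _ => A, fun _ _ => measurable_const, fun _ => hA, hc.continuousOn,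
    fun t _ => ?_⟩, h0, by simpa only [h0] using hd 0⟩
  rw [intervalIntegral.integral_eq_sub_of_hasDerivAt (fun s _ => hd s)
    ((L.continuous.comp hc).intervalIntegrable _ _)]
  abel

/-- Every norm has a supporting linear functional at every point. -/
theorem IsNorm.exists_support {n : ℕ} {v : Vec n → ℝ} (hv : IsNorm v) (z : Vec n) :
    ∃ g : Vec n →L[ℝ] ℝ, g z = v z ∧ ∀ u, g u ≤ v u := by
  obtain ⟨h0, hsmul, hadd⟩ := hv
  have hnonneg : ∀ u, 0 ≤ v u := fun u => by
    have h := hadd u (-u)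
    have h' := hsmul (-1) u
    simp only [add_neg_cancel, (h0 0).2 rfl, neg_smul, one_smul, abs_neg, abs_one, one_mul] at h h'
    linarith
  by_cases hz : z = 0
  · exact ⟨0, by simp [hz, (h0 0).2 rfl], fun u => by simpa using hnonneg u⟩
  obtain ⟨g, hg, hle⟩ := exists_extension_of_le_sublinear
    (LinearPMap.mkSpanSingleton z (v z) hz) v
    (fun c hc u => by rw [hsmul, abs_of_pos hc]) hadd (by
      rintro ⟨u, hu⟩
      obtain ⟨c, rfl⟩ := Submodule.mem_span_singleton.1 hu
      rw [LinearPMap.mkSpanSingleton'_apply, hsmul, smul_eq_mul]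
      exact mul_le_mul_of_nonneg_right (le_abs_self c) (hnonneg z))
  refine ⟨g.toContinuousLinearMap, ?_, hle⟩
  have h := hg ⟨z, Submodule.mem_span_singleton_self z⟩
  rw [LinearPMap.mkSpanSingleton_apply] at h
  exact h

/-- Admissible velocities at a point do not increase a functional supporting a Barabanov norm
there. -/
theorem IsBarabanov.support_mulE_nonpos {n : ℕ} {M : Set (Matrix (Fin n) (Fin n) ℝ)}
    {v : Vec n → ℝ} (hv : IsBarabanov M v) {g : Vec n →L[ℝ] ℝ} (hg : ∀ u, g u ≤ v u)
    {z : Vec n} (hz : g z = v z) {A : Matrix (Fin n) (Fin n) ℝ} (hA : A ∈ M) :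
    g (mulE A z) ≤ 0 := by
  obtain ⟨x, hx, hx0, hd⟩ := exists_isSolution_hasDerivAt hA z
  have hd' : HasDerivWithinAt (fun t => g (x t)) (g (mulE A z)) (Set.Ioi 0) 0 :=
    (g.hasFDerivAt.comp_hasDerivAt 0 hd).hasDerivWithinAt
  rw [hasDerivWithinAt_iff_tendsto_slope' (by simp)] at hd'
  refine le_of_tendsto hd' ?_
  filter_upwards [self_mem_nhdsWithin] with t ht
  rw [slope_def_field]
  refine div_nonpos_of_nonpos_of_nonneg ?_ (by simpa using (le_of_lt ht))
  have h1 := hv.2.1 x hx t (le_of_lt ht)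
  have h2 := hg (x t)
  rw [hx0] at h1 ⊢
  linarith

theorem stmt11 (M : Set (Matrix (Fin 2) (Fin 2) ℝ))
    (hne : M.Nonempty) (hcpt : IsCompact M) (hconv : Convex ℝ M)
    (hirr : MIrreducible M) (hrho : rhoZero M) (hinv : ∀ A ∈ M, IsUnit A)
    (v : Vec 2 → ℝ) (hv : IsBarabanov M v) :
    ∀ x y : Vec 2, x ≠ y → v x = 1 → v y = 1 →
      ∀ lam ∈ Set.Ioo (0:ℝ) 1, v (lam • x + (1 - lam) • y) < 1 := by
  intro x y hxy hx hy lam hlam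
  obtain ⟨hl0, hl1⟩ := hlam
  by_contra! hlt
  obtain ⟨g, hgz, hg⟩ := hv.1.exists_support (lam • x + (1 - lam) • y)
  have hgx : g x = 1 := by
    have := hg x; have := hg y
    simp only [map_add, map_smul, smul_eq_mul] at hgz
    nlinarith
  have hgy : g y = 1 := by
    have := hg y
    simp only [map_add, map_smul, smul_eq_mul] at hgz
    nlinarith
  have hli : LinearIndependent ℝ ![x, y] := by
    rw [LinearIndependent.pair_iff]
    intro s t hst
    have h := congrArg g hst
    simp only [map_add, map_smul, smul_eq_mul, hgx, hgy, map_zero, mul_one] at h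
    obtain rfl : t = -s := by linarith
    have h2 : s • (x - y) = 0 := by rw [← hst]; module
    have h3 : s = 0 := (smul_eq_zero.1 h2).resolve_right (sub_ne_zero.2 hxy)
    simp [h3]
  set b := basisOfLinearIndependentOfCardEqFinrank hli (by simp)
  have hb0 : b 0 = x := by simp [b]
  have hb1 : b 1 = y := by simp [b]
  have hrepr : ∀ u, b.repr u 0 • x + b.repr u 1 • y = u := fun u => by
    have h := b.sum_repr u
    rwa [Fin.sum_univ_two, hb0, hb1] at h
  have hg_eq : ∀ u, g u = b.repr u 0 + b.repr u 1 := fun u => by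
    conv_lhs => rw [← hrepr u]
    simp [hgx, hgy]
  have hvz : v (lam • x + (1 - lam) • y) = 1 := by
    rw [← hgz]; simp [hgx, hgy]
  obtain ⟨X, ⟨A, hXA⟩, hX0, hXv⟩ := hv.2.2 (lam • x + (1 - lam) • y)
  have hcoord : ∀ i, ContinuousOn (fun t => b.repr (X t) i) (Set.Ici 0) := fun i =>
    (b.coord i).continuous_of_finiteDimensional.comp_continuousOn hXA.2.2.1
  have hpos0 : 0 < b.repr (X 0) 0 := by
    rw [hX0, ← hb0, ← hb1]; simpa using hl0
  have hpos1 : 0 < b.repr (X 0) 1 := by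
    rw [hX0, ← hb0, ← hb1]; simpa using hl1
  have hev : ∀ᶠ t in 𝓝[≥] (0 : ℝ), 0 < b.repr (X t) 0 ∧ 0 < b.repr (X t) 1 :=
    ((hcoord 0 0 Set.self_mem_Ici).eventually (lt_mem_nhds hpos0)).and
      ((hcoord 1 0 Set.self_mem_Ici).eventually (lt_mem_nhds hpos1))
  obtain ⟨e, he0, he⟩ := (mem_nhdsGE_iff_exists_Icc_subset).1 hev
  have he0 : (0 : ℝ) < e := he0
  have hgX : ∀ t ∈ Set.Icc 0 e, g (X t) = 1 := fun t ht => by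
    obtain ⟨h0, h1⟩ := he ht
    refine le_antisymm ?_ ?_
    · rw [← hvz, ← hXv t ht.1]; exact hg _
    · rw [← hvz, ← hXv t ht.1, hg_eq]
      conv_lhs => rw [← hrepr (X t)]
      refine (hv.1.2.2 _ _).trans ?_
      rw [hv.1.2.1, hv.1.2.1, hx, hy, abs_of_pos h0, abs_of_pos h1, mul_one, mul_one]
  have hneg : ∀ t ∈ Set.Ioo 0 e, 0 < - g (mulE (A t) (X t)) := fun t ht => by
    obtain ⟨h0, h1⟩ := he (Set.Ioo_subset_Icc_self ht)
    have hAx := hv.support_mulE_nonpos hg (hgx.trans hx.symm) (hXA.2.1 t)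
    have hAy := hv.support_mulE_nonpos hg (hgy.trans hy.symm) (hXA.2.1 t)
    have hsplit : ∀ u, g (mulE (A t) u) =
        b.repr u 0 * g (mulE (A t) x) + b.repr u 1 * g (mulE (A t) y) := fun u => by
      conv_lhs => rw [← hrepr u]
      simp [mulE]
    by_contra! hle
    rw [hsplit] at hle
    have hAx0 : g (mulE (A t) x) = 0 := by nlinarith
    have hAy0 : g (mulE (A t) y) = 0 := by nlinarith
    have hzero : ∀ u, g (mulE (A t) u) = 0 := fun u => by rw [hsplit, hAx0, hAy0]; simp
    have hx' := hzero (mulE (A t)⁻¹ x)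
    have hAinv : mulE (A t) (mulE (A t)⁻¹ x) = x := by
      have hdet := (Matrix.isUnit_iff_isUnit_det _).1 (hinv _ (hXA.2.1 t))
      rw [mulE, mulE, ← LinearMap.comp_apply, ← Matrix.toLpLin_mul_same, Matrix.mul_nonsing_inv _ hdet]
      simp
    rw [hAinv, hgx] at hx'
    exact one_ne_zero hx'
  have hint := hXA.intervalIntegrable hcpt he0.le
  have hcomp := g.intervalIntegral_comp_comm hint
  have hXe := congrArg g (hXA.2.2.2 e he0.le)
  rw [map_add, hgX e ⟨he0.le, le_rfl⟩, hgX 0 ⟨le_rfl, he0.le⟩, ← hcomp] at hXe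
  have hintg : IntervalIntegrable (fun s => g (mulE (A s) (X s))) volume 0 e :=
    ⟨g.integrable_comp hint.1, g.integrable_comp hint.2⟩
  have := intervalIntegral.intervalIntegral_pos_of_pos_on hintg.neg hneg he0
  simp only [Pi.neg_apply, intervalIntegral.integral_neg] at this
  linarith
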